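/- Let G be a finite group such that every nonlinear real-valued irreducible character of G has even degree. Then G has a normal 2-complement, i.e., a normal subgroup N of odd order with G/N a 2-group. -/

import Mathlib

open CategoryTheory

/-- `χ` is the character of an irreducible complex representation of `G`. -/
def IsIrrChar (G : Type) [Group G] (χ : G → ℂ) : Prop :=
  ∃ V : FDRep ℂ G, Simple V ∧ χ = V.character

/-- `χ` is real-valued. -/
def IsRealValued {G : Type} (χ : G → ℂ) : Prop := ∀ g, (χ g).im = 0

open Polynomial in
theorem Polynomial.exists_isRoot_of_odd_natDegree_real {p : Polynomial ℝ} (hp : p.Monic)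
    (hodd : Odd p.natDegree) : ∃ a, p.IsRoot a := by
  have hpos : 0 < p.natDegree := hodd.pos
  have h₁ := p.tendsto_atTop_of_leadingCoeff_nonneg (natDegree_pos_iff_degree_pos.1 hpos)
    (by simp [hp.leadingCoeff])
  have hdeg : (p.comp (-X)).natDegree = p.natDegree := by simp [natDegree_comp]
  have h₂ := (p.comp (-X)).tendsto_atBot_of_leadingCoeff_nonpos
    (natDegree_pos_iff_degree_pos.1 (hdeg ▸ hpos)) (by
      rw [leadingCoeff_comp (by simp)]
      simp [hp.leadingCoeff, hodd.neg_one_pow])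
  obtain ⟨x, hx⟩ := (h₁.eventually (Filter.eventually_ge_atTop 0)).exists
  obtain ⟨y, hy⟩ := (h₂.eventually (Filter.eventually_le_atBot 0)).exists
  rw [eval_comp] at hy
  exact mem_range_of_exists_le_of_exists_ge p.continuous ⟨_, hy⟩ ⟨_, hx⟩

theorem Module.End.exists_hasEigenvalue_of_odd_finrank {V : Type*} [AddCommGroup V] [Module ℝ V]
    [FiniteDimensional ℝ V] (hodd : Odd (Module.finrank ℝ V)) (T : Module.End ℝ V) :
    ∃ a, T.HasEigenvalue a := by
  obtain ⟨a, ha⟩ := Polynomial.exists_isRoot_of_odd_natDegree_real T.charpoly_monic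
    (by rwa [T.charpoly_natDegree])
  exact ⟨a, (Module.End.hasEigenvalue_iff_isRoot_charpoly T a).2 ha⟩

namespace Representation

variable {G V : Type*} [Group G] [AddCommGroup V] [Module ℝ V] [FiniteDimensional ℝ V]

/-- A real representation of odd degree has a subrepresentation of odd degree all of whose
endomorphisms are scalars. -/
theorem exists_odd_subrepresentation (ρ : Representation ℝ G V)
    (hodd : Odd (Module.finrank ℝ V)) :
    ∃ X : Subrepresentation ρ, Odd (Module.finrank ℝ X.toSubmodule) ∧
      ∀ T : IntertwiningMap X.toRepresentation X.toRepresentation,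
        ∃ a : ℝ, ∀ v, T v = a • v := by
  obtain ⟨X, hX, hmin⟩ := WellFounded.has_min
    (InvImage.wf (fun X : Subrepresentation ρ ↦ Module.finrank ℝ X.toSubmodule) wellFounded_lt)
    {X | Odd (Module.finrank ℝ X.toSubmodule)} ⟨⊤, by
      change Odd (Module.finrank ℝ (⊤ : Submodule ℝ V))
      rwa [finrank_top]⟩
  have eq_top : ∀ Y : Submodule ℝ X.toSubmodule,
      (∀ g, ∀ v ∈ Y, X.toRepresentation g v ∈ Y) → Odd (Module.finrank ℝ Y) → Y = ⊤ := by
    intro Y hY hYodd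
    have hfr := Submodule.finrank_map_subtype_eq X.toSubmodule Y
    refine Submodule.eq_top_of_finrank_eq (le_antisymm Y.finrank_le (not_lt.1 fun hlt ↦ ?_))
    refine hmin ⟨Y.map X.toSubmodule.subtype, ?_⟩ (by simpa [hfr] using hYodd)
      (by simpa [InvImage, hfr] using hlt)
    rintro g _ ⟨v, hv, rfl⟩
    exact ⟨_, hY g v hv, rfl⟩
  refine ⟨X, hX, fun T ↦ ?_⟩
  obtain ⟨a, ha⟩ := Module.End.exists_hasEigenvalue_of_odd_finrank hX T.toLinearMap
  refine ⟨a, ?_⟩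
  set S : Module.End ℝ X.toSubmodule := T.toLinearMap - algebraMap ℝ _ a
  have hS : ∀ g v, S (X.toRepresentation g v) = X.toRepresentation g (S v) := by
    intro g v
    have := LinearMap.congr_fun (T.isIntertwining' g) v
    simp only [LinearMap.comp_apply] at this
    simp [S, this]
  have hker : LinearMap.ker S ≠ ⊥ := by
    simpa [Module.End.HasEigenvalue, Module.End.HasUnifEigenvalue,
      Module.End.eigenspace_def, S, Algebra.algebraMap_eq_smul_one] using ha
  suffices LinearMap.ker S = ⊤ by
    intro v
    have : S v = 0 := by simp [← LinearMap.mem_ker, this]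
    simpa [S, sub_eq_zero] using this
  have hsum := LinearMap.finrank_range_add_finrank_ker S
  rcases Nat.even_or_odd (Module.finrank ℝ (LinearMap.ker S)) with he | ho
  · have hr : Odd (Module.finrank ℝ (LinearMap.range S)) := by
      rw [Set.mem_ofPred_eq, ← hsum] at hX
      exact (Nat.odd_add.1 hX).2 he
    have := eq_top _ (by rintro g _ ⟨v, rfl⟩; exact ⟨_, hS g v⟩) hr
    exact absurd (LinearMap.ker_eq_bot_iff_range_eq_top.2 this) hker
  · exact eq_top _ (fun g v hv ↦ by
      rw [LinearMap.mem_ker] at hv ⊢; rw [hS, hv, map_zero]) ho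

end Representation

/-- The complexification of a real representation with only scalar endomorphisms is irreducible. -/
theorem exists_isIrrChar_of_endomorphisms_scalar {G X : Type} [Group G] [Fintype G]
    [AddCommGroup X] [Module ℝ X] [FiniteDimensional ℝ X] [Nontrivial X]
    (ρ : Representation ℝ G X)
    (hρ : ∀ T : ρ.IntertwiningMap ρ, ∃ a : ℝ, ∀ v, T v = a • v) :
    ∃ χ : G → ℂ, IsIrrChar G χ ∧ IsRealValued χ ∧ χ 1 = Module.finrank ℝ X := by
  let ρC : Representation ℂ G (TensorProduct ℝ ℂ X) :=
    { toFun := fun g ↦ (ρ g).baseChange ℂ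
      map_one' := by simp
      map_mul' := fun g h ↦ by simp [LinearMap.baseChange_mul] }
  have hchar : ∀ g, (FDRep.of ρC).character g = (ρ.character g : ℂ) := fun g ↦
    LinearMap.trace_baseChange (ρ g) ℂ
  refine ⟨(FDRep.of ρC).character, ⟨_, ?_, rfl⟩, fun g ↦ by simp [hchar], by simp [hchar]⟩
  rw [FDRep.simple_iff_char_is_norm_one]
  have hone : Module.finrank ℝ (ρ.IntertwiningMap ρ) = 1 := by
    obtain ⟨v, hv⟩ := exists_ne (0 : X)
    refine finrank_eq_one (1 : ρ.IntertwiningMap ρ) (fun h ↦ hv ?_) fun T ↦ ?_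
    · exact congrArg (fun T : ρ.IntertwiningMap ρ ↦ T v) h
    · obtain ⟨a, ha⟩ := hρ T
      exact ⟨a, by ext v; exact (ha v).symm⟩
  have hcard : (Nat.card G : ℝ) ≠ 0 := by simp
  have := ρ.card_inv_mul_sum_char_mul_char_eq_finrank ρ
  rw [hone, Nat.cast_one, inv_mul_eq_one₀ hcard] at this
  simp only [hchar]
  exact_mod_cast this.symm

theorem exists_eigenvector_of_even_real_degrees {G V : Type} [Group G] [Fintype G]
    [AddCommGroup V] [Module ℝ V] [FiniteDimensional ℝ V]
    (hdeg : ∀ χ : G → ℂ, IsIrrChar G χ → IsRealValued χ → χ 1 ≠ 1 →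
      ∃ n : ℕ, Even n ∧ χ 1 = (n : ℂ))
    (ρ : Representation ℝ G V) (hodd : Odd (Module.finrank ℝ V)) :
    ∃ v : V, v ≠ 0 ∧ ∃ μ : G →* ℝ, ∀ g, ρ g v = μ g • v := by
  obtain ⟨X, hX, hscal⟩ := ρ.exists_odd_subrepresentation hodd
  have : Nontrivial X.toSubmodule := Module.nontrivial_of_finrank_pos hX.pos
  obtain ⟨χ, hirr, hreal, hχ⟩ := exists_isIrrChar_of_endomorphisms_scalar _ hscal
  have hone : Module.finrank ℝ X.toSubmodule = 1 := by
    by_contra hne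
    obtain ⟨n, hn, hχn⟩ := hdeg χ hirr hreal (by rw [hχ]; exact_mod_cast hne)
    rw [hχ, Nat.cast_inj] at hχn
    exact Nat.not_even_iff_odd.2 hX (hχn ▸ hn)
  obtain ⟨v, hv, hspan⟩ := finrank_eq_one_iff'.1 hone
  choose μ hμ using fun g ↦ hspan (X.toRepresentation g v)
  have hinj : ∀ {a b : ℝ}, a • v = b • v → a = b := fun h ↦ smul_left_injective ℝ hv h
  refine ⟨v, by simpa using hv, ⟨⟨μ, hinj ?_⟩, fun g h ↦ hinj ?_⟩, fun g ↦
    (congrArg Subtype.val (hμ g)).symm⟩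
  · rw [hμ]; simp
  · change μ (g * h) • v = (μ g * μ h) • v
    rw [hμ, map_mul, Module.End.mul_apply, ← hμ h, map_smul, ← hμ g, smul_smul, mul_comm]

/-- The functions on `G` that transform under right translation by `P` through `l`: the
representation space of the induced representation of `l`. -/
def equivariantFunctions {G : Type} [Group G] (P : Subgroup G) (l : P →* ℝ) :
    Submodule ℝ (G → ℝ) where
  carrier := {F | ∀ g (p : P), F (g * p) = l p * F g}
  zero_mem' := by simp
  add_mem' hF hF' g p := by simp [hF g p, hF' g p, mul_add]
  smul_mem' a F hF g p := by simp [hF g p, mul_left_comm]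

theorem finrank_equivariantFunctions {G : Type} [Group G] [Fintype G] (P : Subgroup G)
    (l : P →* ℝ) : Module.finrank ℝ (equivariantFunctions P l) = P.index := by
  have hmem : ∀ g : G, (g : G ⧸ P).out⁻¹ * g ∈ P := fun g ↦
    QuotientGroup.eq.1 (QuotientGroup.out_eq' _)
  have := Fintype.ofFinite (G ⧸ P)
  let e : equivariantFunctions P l ≃ₗ[ℝ] (G ⧸ P → ℝ) :=
    { toFun := fun F q ↦ F.1 q.out
      map_add' := fun _ _ ↦ rfl
      map_smul' := fun _ _ ↦ rfl
      invFun := fun f ↦ ⟨fun g ↦ l ⟨_, hmem g⟩ * f g, fun g p ↦ by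
        have hq : ((g * p : G) : G ⧸ P) = g := QuotientGroup.mk_mul_of_mem g p.2
        have : (⟨_, hmem (g * p)⟩ : P) = ⟨_, hmem g⟩ * p := by
          ext; simp [hq, mul_assoc]
        change l ⟨_, hmem (g * p)⟩ * f ((g * p : G) : G ⧸ P) = l p * (l ⟨_, hmem g⟩ * f g)
        rw [this, hq, map_mul]
        ring⟩
      left_inv := fun F ↦ by
        ext g
        have := F.2 (g : G ⧸ P).out ⟨_, hmem g⟩
        simpa using this.symm
      right_inv := fun f ↦ by
        ext q
        have : (⟨_, hmem q.out⟩ : P) = 1 := by ext; simp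
        change l _ * f (q.out : G ⧸ P) = f q
        rw [this, map_one, one_mul, QuotientGroup.out_eq'] }
  rw [e.finrank_eq, Module.finrank_fintype_fun_eq_card, ← Nat.card_eq_fintype_card,
    Subgroup.index]

/-- The left translation action on `equivariantFunctions P l`. -/
def equivariantFunctionsRep {G : Type} [Group G] (P : Subgroup G) (l : P →* ℝ) :
    Representation ℝ G (equivariantFunctions P l) where
  toFun g :=
    { toFun := fun F ↦ ⟨fun x ↦ F.1 (g⁻¹ * x), fun x p ↦ by
        simpa only [mul_assoc] using F.2 (g⁻¹ * x) p⟩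
      map_add' := fun _ _ ↦ rfl
      map_smul' := fun _ _ ↦ rfl }
  map_one' := by ext; simp
  map_mul' g h := by ext; simp [mul_assoc]

theorem exists_extension_of_even_real_degrees {G : Type} [Group G] [Fintype G]
    (hdeg : ∀ χ : G → ℂ, IsIrrChar G χ → IsRealValued χ → χ 1 ≠ 1 →
      ∃ n : ℕ, Even n ∧ χ 1 = (n : ℂ))
    (P : Subgroup G) (hP : Odd P.index) (l : P →* ℝ) :
    ∃ μ : G →* ℝ, ∀ p : P, μ p = l p⁻¹ := by
  obtain ⟨F, hF, μ, hμ⟩ := exists_eigenvector_of_even_real_degrees hdeg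
    (equivariantFunctionsRep P l) (by rwa [finrank_equivariantFunctions])
  have key : ∀ g x, F.1 (g⁻¹ * x) = μ g * F.1 x := fun g x ↦
    congrFun (congrArg Subtype.val (hμ g)) x
  have hF1 : F.1 1 ≠ 0 := by
    intro h
    refine hF (Subtype.ext (funext fun g ↦ ?_))
    simpa [h] using key g⁻¹ 1
  refine ⟨μ, fun p ↦ mul_right_cancel₀ hF1 ?_⟩
  rw [← key, ← F.2]
  simp

/-- A normal subgroup containing all squares which cuts out a given homomorphism from a subgroup
of odd index to the group with two elements. -/
theorem exists_normal_extending_kernel {G : Type} [Group G] [Fintype G]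
    (hdeg : ∀ χ : G → ℂ, IsIrrChar G χ → IsRealValued χ → χ 1 ≠ 1 →
      ∃ n : ℕ, Even n ∧ χ 1 = (n : ℂ))
    (P : Subgroup G) (hP : Odd P.index) (f : G → ZMod 2)
    (hf : ∀ x ∈ P, ∀ y ∈ P, f (x * y) = f x + f y) :
    ∃ M : Subgroup G, M.Normal ∧ (∀ g, g ^ 2 ∈ M) ∧ ∀ p ∈ P, p ∈ M → f p = 0 := by
  let sgn : ZMod 2 → ℝ := fun a ↦ if a = 0 then 1 else -1
  have hsgn : ∀ a b, sgn (a + b) = sgn a * sgn b := by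
    have key : ∀ a b : ZMod 2, (a + b = 0 ↔ (a = 0 ↔ b = 0)) := by decide
    intro a b
    by_cases ha : a = 0 <;> by_cases hb : b = 0 <;> simp [sgn, key, ha, hb]
  have hf1 : f 1 = 0 := by simpa using hf 1 P.one_mem 1 P.one_mem
  obtain ⟨μ, hμ⟩ := exists_extension_of_even_real_degrees hdeg P hP
    { toFun := fun p ↦ sgn (f p)
      map_one' := by simp [hf1, sgn]
      map_mul' := fun x y ↦ by simp [hf x x.2 y y.2, hsgn] }
  refine ⟨μ.ker, inferInstance, fun g ↦ ?_, fun p hp hpM ↦ ?_⟩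
  · have h : μ g ^ Nat.card G = 1 := by rw [← map_pow, pow_card_eq_one', map_one]
    rw [MonoidHom.mem_ker, map_pow]
    have habs : |μ g| = 1 := (pow_eq_one_iff_of_nonneg (abs_nonneg _) Nat.card_pos.ne').1 (by
      rw [← abs_pow, h, abs_one])
    rw [← sq_abs, habs, one_pow]
  · have h₁ : μ (p⁻¹ : G) = sgn (f p) := by simpa using hμ ⟨p, hp⟩⁻¹
    rw [MonoidHom.mem_ker.1 (inv_mem hpM)] at h₁
    by_contra hne
    norm_num [sgn, hne] at h₁

/-- A `2`-cocycle with values in `ZMod 2` is a coboundary if its restriction to a subgroup of odd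
index is. -/
theorem exists_coboundary_of_odd_index {G : Type*} [Group G] [Finite G] (P : Subgroup G)
    (hP : Odd P.index) (c : G → G → ZMod 2)
    (hc : ∀ x y z, c y z - c (x * y) z + c x (y * z) - c x y = 0) (f : G → ZMod 2)
    (hf : ∀ x ∈ P, ∀ y ∈ P, c x y = f x + f y - f (x * y)) :
    ∃ h : G → ZMod 2, ∀ x y, c x y = h x + h y - h (x * y) := by
  have := Fintype.ofFinite (G ⧸ P)
  let C : G → G → G → ZMod 2 := fun x y z ↦ c (x⁻¹ * y) (y⁻¹ * z)
  have hC : ∀ w x y z, C x y z - C w y z + C w x z - C w x y = 0 := by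
    intro w x y z
    simpa [C, mul_assoc] using hc (w⁻¹ * x) (x⁻¹ * y) (y⁻¹ * z)
  have hCmul : ∀ g x y z, C (g * x) (g * y) (g * z) = C x y z := by simp [C, mul_assoc]
  let π : G → G := fun g ↦ g * ((g⁻¹ : G) : G ⧸ P).out
  have hπ : ∀ g, π g ∈ P := fun g ↦ by
    have : (g⁻¹)⁻¹ * ((g⁻¹ : G) : G ⧸ P).out ∈ P :=
      QuotientGroup.eq.1 (QuotientGroup.out_eq' _).symm
    simpa [π] using this
  have hπmul : ∀ p ∈ P, ∀ g, π (p * g) = p * π g := by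
    intro p hp g
    have : ((g⁻¹ * p⁻¹ : G) : G ⧸ P) = (g⁻¹ : G) := QuotientGroup.mk_mul_of_mem _ (inv_mem hp)
    simp [π, this, mul_assoc]
  have hCP : ∀ x y z, C (π x) (π y) (π z) =
      f ((π x)⁻¹ * π y) + f ((π y)⁻¹ * π z) - f ((π x)⁻¹ * π z) := by
    intro x y z
    have := hf _ (mul_mem (inv_mem (hπ x)) (hπ y)) _ (mul_mem (inv_mem (hπ y)) (hπ z))
    simpa [C, mul_assoc] using this
  let U : G → G → ZMod 2 := fun x y ↦ f ((π x)⁻¹ * π y) + C (π x) x y - C (π x) (π y) y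
  have hU : ∀ x y z, C x y z = U x y + U y z - U x z := by
    intro x y z
    linear_combination hC (π x) x y z - hC (π x) (π y) y z + hC (π x) (π y) (π z) z + hCP x y z
  have hUmul : ∀ p ∈ P, ∀ x y, U (p * x) (p * y) = U x y := by
    intro p hp x y
    simp only [U, hπmul p hp, hCmul]
    simp [mul_assoc]
  let W : G → G → G ⧸ P → ZMod 2 := fun x y q ↦ Quotient.liftOn' q (fun t ↦ U (t⁻¹ * x) (t⁻¹ * y))
    (fun s t hst ↦ by
      rw [QuotientGroup.leftRel_apply] at hst
      simpa [mul_assoc] using hUmul _ hst (t⁻¹ * x) (t⁻¹ * y))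
  have hW : ∀ g x y q, W (g * x) (g * y) (g • q) = W x y q := by
    rintro g x y ⟨t⟩
    change U ((g * t)⁻¹ * (g * x)) ((g * t)⁻¹ * (g * y)) = U (t⁻¹ * x) (t⁻¹ * y)
    simp [mul_assoc]
  have hWC : ∀ x y z q, C x y z = W x y q + W y z q - W x z q := by
    rintro x y z ⟨t⟩
    rw [← hCmul t⁻¹]
    exact hU _ _ _
  let S : G → G → ZMod 2 := fun x y ↦ ∑ q, W x y q
  have hS : ∀ g x y, S (g * x) (g * y) = S x y := fun g x y ↦ by
    change ∑ q, W (g * x) (g * y) q = _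
    rw [← Equiv.sum_comp (MulAction.toPerm g)]
    exact Finset.sum_congr rfl fun q _ ↦ hW g x y q
  have hSC : ∀ x y z, C x y z = S x y + S y z - S x z := by
    intro x y z
    have hone : ((Fintype.card (G ⧸ P) : ℕ) : ZMod 2) = 1 := by
      rw [← Nat.card_eq_fintype_card]
      exact ZMod.natCast_eq_one_iff_odd.2 hP
    rw [← Finset.sum_add_distrib, ← Finset.sum_sub_distrib,
      ← Finset.sum_congr rfl fun q _ ↦ hWC x y z q]
    simp [hone]
  refine ⟨fun x ↦ S 1 x, fun x y ↦ ?_⟩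
  have h₁ : C 1 x (x * y) = c x y := by simp [C]
  have h₂ : S x (x * y) = S 1 y := by simpa using hS x 1 y
  rw [← h₁, hSC, h₂]

/-- A nontrivial normal subgroup of a finite `2`-group contains a central involution. -/
theorem IsPGroup.exists_central_involution_mem {Q : Type*} [Group Q] [Finite Q] (hQ : IsPGroup 2 Q)
    (D : Subgroup Q) [D.Normal] (hD : D ≠ ⊥) :
    ∃ z ∈ D, z ≠ 1 ∧ z ^ 2 = 1 ∧ ∀ g, g * z = z * g := by
  have hdvd : 2 ∣ Nat.card D :=
    (hQ.to_subgroup D).card_eq_or_dvd.resolve_left (by rwa [Subgroup.card_eq_one])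
  obtain ⟨⟨z, hzD⟩, hfix, hz⟩ :=
    (hQ.of_equiv ConjAct.toConjAct).exists_fixed_point_of_prime_dvd_card_of_fixed_point D
      hdvd (a := 1) (fun g ↦ smul_one g)
  have hcomm : ∀ g, g * z = z * g := fun g ↦ by
    have := congrArg Subtype.val (hfix (ConjAct.toConjAct g))
    rw [ConjAct.Subgroup.val_conj_smul, ConjAct.smul_def, ConjAct.ofConjAct_toConjAct] at this
    exact mul_inv_eq_iff_eq_mul.1 this
  have hz1 : z ≠ 1 := fun h ↦ hz (Subtype.ext h.symm)
  obtain ⟨k, hk⟩ := IsPGroup.iff_orderOf.1 hQ z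
  cases k with
  | zero => exact absurd (orderOf_eq_one_iff.1 (by simpa using hk)) hz1
  | succ k =>
    refine ⟨z ^ 2 ^ k, pow_mem hzD _, fun h ↦ ?_, ?_, fun g ↦ Commute.pow_right (hcomm g) _⟩
    · have := Nat.le_of_dvd (by positivity) (orderOf_dvd_of_pow_eq_one h)
      rw [hk, pow_succ] at this
      have : 0 < 2 ^ k := by positivity
      omega
    · rw [← pow_mul, ← pow_succ, ← hk, pow_orderOf_eq_one]

/-- A nontrivial normal subgroup `D` of a finite `2`-group `Q` contains a normal subgroup of `Q`
with index two in `D`. -/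
theorem IsPGroup.exists_normal_index_two {Q : Type*} [Group Q] [Finite Q] (hQ : IsPGroup 2 Q)
    (D : Subgroup Q) [hDn : D.Normal] (hD : D ≠ ⊥) :
    ∃ E : Subgroup Q, E.Normal ∧ E < D ∧ ∀ x ∈ D, ∀ y ∈ D, (x * y ∈ E ↔ (x ∈ E ↔ y ∈ E)) := by
  obtain ⟨E, ⟨hE, hED⟩, hmax⟩ := WellFounded.has_min (wellFounded_gt (α := Subgroup Q))
    {E | E.Normal ∧ E < D} ⟨⊥, inferInstance, bot_lt_iff_ne_bot.2 hD⟩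
  have hmapn : (D.map (QuotientGroup.mk' E)).Normal :=
    hDn.map _ (QuotientGroup.mk'_surjective E)
  have hmap : D.map (QuotientGroup.mk' E) ≠ ⊥ := by
    rw [Ne, Subgroup.map_eq_bot_iff, QuotientGroup.ker_mk']
    exact not_le_of_gt hED
  obtain ⟨z, hzD, hz1, hz2, hzc⟩ := (hQ.to_quotient E).exists_central_involution_mem _ hmap
  have hzn : (Subgroup.zpowers z).Normal := ⟨by
    rintro _ ⟨n, rfl⟩ g
    have : g * z ^ n = z ^ n * g := Commute.zpow_right (hzc g) n
    exact ⟨n, by simp [this]⟩⟩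
  set N := (Subgroup.zpowers z).comap (QuotientGroup.mk' E) with hN
  have hEN : E < N := by
    refine lt_of_le_of_ne (fun x hx ↦ ?_) fun h ↦ hz1 ?_
    · rw [hN, Subgroup.mem_comap, QuotientGroup.mk'_apply, (QuotientGroup.eq_one_iff x).2 hx]
      exact one_mem _
    · obtain ⟨x, rfl⟩ := QuotientGroup.mk'_surjective E z
      refine (QuotientGroup.eq_one_iff x).2 ?_
      rw [h]
      exact Subgroup.mem_zpowers _
  have hND : N ≤ D := by
    have : N ≤ (D.map (QuotientGroup.mk' E)).comap (QuotientGroup.mk' E) :=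
      Subgroup.comap_mono (by simpa using hzD)
    rwa [Subgroup.comap_map_eq, QuotientGroup.ker_mk', sup_eq_left.2 hED.le] at this
  have hDN : D = N := by
    by_contra hne
    exact hmax N ⟨inferInstance, lt_of_le_of_ne hND (Ne.symm hne)⟩ hEN
  have hcase : ∀ x ∈ D, (x : Q ⧸ E) = 1 ∨ (x : Q ⧸ E) = z := by
    intro x hx
    rw [hDN] at hx
    obtain ⟨n, hn⟩ := hx
    change z ^ n = (x : Q ⧸ E) at hn
    rw [← hn]
    have hz2' : z ^ (2 : ℤ) = 1 := by exact_mod_cast hz2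
    obtain ⟨m, rfl⟩ | ⟨m, rfl⟩ := n.even_or_odd
    · left; rw [← two_mul, zpow_mul, hz2', one_zpow]
    · right; rw [zpow_add, zpow_mul, hz2', one_zpow, one_mul, zpow_one]
  refine ⟨E, hE, hED, fun x hx y hy ↦ ?_⟩
  simp only [← QuotientGroup.eq_one_iff, QuotientGroup.mk_mul]
  rw [pow_two] at hz2
  rcases hcase x hx with h | h <;> rcases hcase y hy with h' | h' <;> simp [h, h', hz1, hz2]

theorem exists_invariant_hom {G : Type*} [Group G] [Finite G] (P D : Subgroup G)
    (hP : IsPGroup 2 P) (hDP : D ≤ P) (hD : D ≠ ⊥) (hn : ∀ p ∈ P, ∀ d ∈ D, p * d * p⁻¹ ∈ D) :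
    ∃ φ : G → ZMod 2, (∀ x ∈ D, ∀ y ∈ D, φ (x * y) = φ x + φ y) ∧
      (∀ p ∈ P, ∀ d ∈ D, φ (p * d * p⁻¹) = φ d) ∧ ∃ d ∈ D, φ d ≠ 0 := by
  classical
  have : (D.subgroupOf P).Normal := ⟨fun d hd p ↦ hn p p.2 d hd⟩
  obtain ⟨E, hE, hED, hmul⟩ := hP.exists_normal_index_two (D.subgroupOf P) (by
    rwa [Ne, Subgroup.subgroupOf_eq_bot, disjoint_iff, inf_eq_left.2 hDP])
  have hmem : ∀ x (hx : x ∈ P), x ∈ E.map P.subtype ↔ ⟨x, hx⟩ ∈ E := by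
    intro x hx
    simp [hx]
  refine ⟨fun x ↦ if x ∈ E.map P.subtype then 0 else 1, fun x hx y hy ↦ ?_, fun p hp d hd ↦ ?_, ?_⟩
  · have := hmul ⟨x, hDP hx⟩ hx ⟨y, hDP hy⟩ hy
    simp only [hmem _ (mul_mem (hDP hx) (hDP hy)), hmem _ (hDP hx), hmem _ (hDP hy)]
    rw [MulMemClass.mk_mul_mk] at this
    rw [if_congr this rfl rfl]
    by_cases h₁ : (⟨x, hDP hx⟩ : P) ∈ E <;> by_cases h₂ : (⟨y, hDP hy⟩ : P) ∈ E <;>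
      simp [h₁, h₂, CharTwo.add_self_eq_zero]
  · refine if_congr ?_ rfl rfl
    rw [hmem _ (hDP (hn p hp d hd)), hmem _ (hDP hd)]
    refine ⟨fun h ↦ ?_, fun h ↦ hE.conj_mem _ h ⟨p, hp⟩⟩
    convert hE.conj_mem _ h ⟨p, hp⟩⁻¹ using 1
    ext
    simp [mul_assoc]
  · obtain ⟨d, hd, hdE⟩ := SetLike.exists_of_lt hED
    refine ⟨d, hd, ?_⟩
    simp [hmem d d.2, hdE]

/-- The inductive step of Tate's theorem: if every homomorphism from `P` to the group with two
elements extends to `G`, then every `P`-invariant homomorphism from `P ⊓ K` to the group with two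
elements is trivial, where `K` is the smallest normal subgroup whose quotient is a `2`-group. -/
theorem invariant_hom_eq_zero {G : Type*} [Group G] [Finite G] (P K : Subgroup G) [hK : K.Normal]
    (hP : Odd P.index) (hPK : P ⊔ K = ⊤) (hpow : ∀ g : G, ∃ k : ℕ, g ^ 2 ^ k ∈ K)
    (hmin : ∀ M : Subgroup G, M.Normal → (∀ g : G, ∃ k : ℕ, g ^ 2 ^ k ∈ M) → K ≤ M)
    (hext : ∀ f : G → ZMod 2, (∀ x ∈ P, ∀ y ∈ P, f (x * y) = f x + f y) →
      ∃ M : Subgroup G, M.Normal ∧ (∀ g, g ^ 2 ∈ M) ∧ ∀ p ∈ P, p ∈ M → f p = 0)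
    (φ : G → ZMod 2) (hφ : ∀ x ∈ P ⊓ K, ∀ y ∈ P ⊓ K, φ (x * y) = φ x + φ y)
    (hφP : ∀ p ∈ P, ∀ d ∈ P ⊓ K, φ (p * d * p⁻¹) = φ d) : ∀ d ∈ P ⊓ K, φ d = 0 := by
  have hrep : ∀ q : G ⧸ K, ∃ p ∈ P, (p : G ⧸ K) = q := by
    rintro ⟨g⟩
    obtain ⟨p, hp, k, hk, rfl⟩ := Subgroup.mem_sup_of_normal_right.1
      (hPK ▸ Subgroup.mem_top g : g ∈ P ⊔ K)
    exact ⟨p, hp, (QuotientGroup.mk_mul_of_mem p hk).symm⟩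
  choose r hrP hr using hrep
  let s : G → G := fun g ↦ r g
  have hsP : ∀ g, s g ∈ P := fun g ↦ hrP g
  have hsmk : ∀ g, (s g : G ⧸ K) = g := fun g ↦ hr g
  have hcongr : ∀ {x y : G}, (x : G ⧸ K) = y → s x = s y := fun h ↦ congrArg r h
  have hleft : ∀ k ∈ K, ∀ x, ((k * x : G) : G ⧸ K) = x := fun k hk x ↦ by
    rw [QuotientGroup.mk_mul, (QuotientGroup.eq_one_iff k).2 hk, one_mul]
  have hdiv : ∀ x ∈ P, x * (s x)⁻¹ ∈ P ⊓ K := fun x hx ↦ by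
    refine ⟨P.mul_mem hx (P.inv_mem (hsP x)), (QuotientGroup.eq_one_iff _).1 ?_⟩
    rw [QuotientGroup.mk_mul, QuotientGroup.mk_inv, hsmk, mul_inv_cancel]
  let f₀ : G → ZMod 2 := fun x ↦ φ (x * (s x)⁻¹)
  have hf₀ : ∀ d ∈ P ⊓ K, ∀ x ∈ P, f₀ (d * x) = φ d + f₀ x := fun d hd x hx ↦ by
    rw [← hφ d hd _ (hdiv x hx), ← mul_assoc]
    simp only [f₀, hcongr (hleft d hd.2 x)]
  let f : G → ZMod 2 := fun x ↦ f₀ x - f₀ 1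
  have hf1 : f 1 = 0 := sub_self _
  have hfd : ∀ d ∈ P ⊓ K, ∀ x ∈ P, f (d * x) = φ d + f x := fun d hd x hx ↦ by
    simp only [f, hf₀ d hd x hx, add_sub_assoc]
  let c : G → G → ZMod 2 := fun x y ↦ f (s x) + f (s y) - f (s x * s y)
  have hconj : ∀ p ∈ P, ∀ d ∈ P ⊓ K, p * d * p⁻¹ ∈ P ⊓ K := fun p hp d hd ↦
    ⟨P.mul_mem (P.mul_mem hp hd.1) (P.inv_mem hp), hK.conj_mem d hd.2 p⟩
  have hcP : ∀ x ∈ P, ∀ y ∈ P, c x y = f x + f y - f (x * y) := by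
    intro x hx y hy
    have h₁ := hfd _ (hdiv x hx) _ (hsP x)
    have h₂ := hfd _ (hdiv y hy) _ (hsP y)
    have h₃ := hfd _ (mul_mem (hdiv x hx) (hconj _ (hsP x) _ (hdiv y hy))) _
      (mul_mem (hsP x) (hsP y))
    rw [hφ _ (hdiv x hx) _ (hconj _ (hsP x) _ (hdiv y hy)), hφP _ (hsP x) _ (hdiv y hy)] at h₃
    simp only [mul_assoc, inv_mul_cancel, mul_one, inv_mul_cancel_left] at h₁ h₂ h₃
    simp only [c, h₁, h₂, h₃]
    ring
  have hccongr : ∀ {x y x' y' : G}, (x : G ⧸ K) = x' → (y : G ⧸ K) = y' → c x y = c x' y' :=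
    fun hx hy ↦ by simp only [c, hcongr hx, hcongr hy]
  have hcs : ∀ x y, c x y = c (s x) (s y) := fun x y ↦ hccongr (hsmk x).symm (hsmk y).symm
  have hsmul : ∀ x y, ((x * y : G) : G ⧸ K) = (s x * s y : G) := fun x y ↦ by
    simp only [QuotientGroup.mk_mul, hsmk]
  obtain ⟨h, hh⟩ := exists_coboundary_of_odd_index P hP c (fun x y z ↦ by
    rw [hcs y z, hccongr (hsmul x y) (hsmk z).symm, hccongr (hsmk x).symm (hsmul y z), hcs x y,
      hcP _ (hsP y) _ (hsP z), hcP _ (mul_mem (hsP x) (hsP y)) _ (hsP z),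
      hcP _ (hsP x) _ (mul_mem (hsP y) (hsP z)), hcP _ (hsP x) _ (hsP y), mul_assoc]
    ring) f hcP
  have hKleft : ∀ k ∈ K, ∀ x, h (k * x) = h k + h x := by
    intro k hk x
    have h₁ := hh k x
    rw [hccongr (x' := 1) ((QuotientGroup.eq_one_iff k).2 hk) (hsmk x).symm,
      hcP _ P.one_mem _ (hsP x), hf1, one_mul] at h₁
    linear_combination h₁
  have hKright : ∀ k ∈ K, ∀ x, h (x * k) = h x + h k := by
    intro k hk x
    have h₁ := hh x k
    rw [hccongr (y' := 1) (hsmk x).symm ((QuotientGroup.eq_one_iff k).2 hk),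
      hcP _ (hsP x) _ P.one_mem, hf1, mul_one] at h₁
    linear_combination h₁
  have h_one : h 1 = 0 := by simpa using hKleft 1 K.one_mem 1
  let M : Subgroup G :=
    { carrier := {k | k ∈ K ∧ h k = 0}
      one_mem' := ⟨K.one_mem, h_one⟩
      mul_mem' := fun {a b} ha hb ↦ ⟨mul_mem ha.1 hb.1, by rw [hKleft a ha.1, ha.2, hb.2, add_zero]⟩
      inv_mem' := fun {a} ha ↦ ⟨inv_mem ha.1, by
        have := hKleft a ha.1 a⁻¹
        rwa [mul_inv_cancel, h_one, ha.2, zero_add, eq_comm] at this⟩ }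
  have hM : M.Normal := ⟨fun k hk g ↦ by
    refine ⟨hK.conj_mem k hk.1 g, ?_⟩
    have := hKleft _ (hK.conj_mem k hk.1 g) g
    rw [inv_mul_cancel_right, hKright k hk.1, hk.2] at this
    linear_combination -this⟩
  have hhK : ∀ k ∈ K, h k = 0 := fun k hk ↦ (hmin M hM (fun g ↦ by
    obtain ⟨n, hn⟩ := hpow g
    refine ⟨n + 1, ?_⟩
    rw [pow_succ, pow_mul, pow_two]
    exact ⟨mul_mem hn hn, by rw [hKleft _ hn, CharTwo.add_self_eq_zero]⟩) hk).2
  obtain ⟨M', hM', hsq, hM'P⟩ := hext (fun x ↦ f x - h x) (fun x hx y hy ↦ by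
    linear_combination hcP x hx y hy - hh x y)
  intro d hd
  have h₁ := hM'P d hd.1 (hmin M' hM' (fun g ↦ ⟨1, hsq g⟩) hd.2)
  have h₂ := hfd d hd 1 P.one_mem
  rw [mul_one, hf1, add_zero] at h₂
  simpa [h₂, hhK d hd.2] using h₁

/-- **Tate's theorem** for the prime two: if every homomorphism from a Sylow `2`-subgroup to the
group with two elements extends to `G`, then `G` has a normal `2`-complement. -/
theorem exists_normal_two_complement_of_extends {G : Type*} [Group G] [Finite G] (P : Sylow 2 G)
    (hext : ∀ f : G → ZMod 2, (∀ x ∈ P.1, ∀ y ∈ P.1, f (x * y) = f x + f y) →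
      ∃ M : Subgroup G, M.Normal ∧ (∀ g, g ^ 2 ∈ M) ∧ ∀ p ∈ P.1, p ∈ M → f p = 0) :
    ∃ N : Subgroup G, N.Normal ∧ Odd (Nat.card N) ∧ ∃ k : ℕ, N.index = 2 ^ k := by
  have hP : Odd P.1.index := by
    rw [← Nat.not_even_iff_odd, even_iff_two_dvd]
    exact P.not_dvd_index
  obtain ⟨K, ⟨hK, hpow⟩, hKmin⟩ := WellFounded.has_min (wellFounded_lt (α := Subgroup G))
    {K | K.Normal ∧ ∀ g : G, ∃ k : ℕ, g ^ 2 ^ k ∈ K} ⟨⊤, inferInstance, by simp⟩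
  have hmin : ∀ M : Subgroup G, M.Normal → (∀ g : G, ∃ k : ℕ, g ^ 2 ^ k ∈ M) → K ≤ M := by
    intro M hM hMpow
    refine inf_eq_left.1 (by_contra fun hne ↦ hKmin (K ⊓ M) ⟨inferInstance, fun g ↦ ?_⟩
      (lt_of_le_of_ne inf_le_left hne))
    obtain ⟨a, ha⟩ := hpow g
    obtain ⟨b, hb⟩ := hMpow g
    refine ⟨a + b, ?_, ?_⟩
    · rw [pow_add, pow_mul]; exact pow_mem ha _
    · rw [add_comm, pow_add, pow_mul]; exact pow_mem hb _
  have hquot : IsPGroup 2 (G ⧸ K) := by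
    rintro ⟨g⟩
    obtain ⟨k, hk⟩ := hpow g
    exact ⟨k, (QuotientGroup.eq_one_iff _).2 hk⟩
  obtain ⟨k, hk⟩ := IsPGroup.iff_card.1 hquot
  have hPK : P.1 ⊔ K = ⊤ := by
    rw [← Subgroup.index_eq_one]
    have h₁ : (P.1 ⊔ K).index ∣ P.1.index := Subgroup.index_dvd_of_le le_sup_left
    have h₂ : (P.1 ⊔ K).index ∣ 2 ^ k := hk ▸ Subgroup.index_dvd_of_le le_sup_right
    exact Nat.eq_one_of_dvd_coprimes (Nat.Coprime.pow_right k (Nat.coprime_two_right.2 hP)) h₁ h₂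
  have hdisj : P.1 ⊓ K = ⊥ := by
    by_contra hne
    obtain ⟨φ, hφ, hφP, d, hd, hφd⟩ := exists_invariant_hom P.1 (P.1 ⊓ K) P.isPGroup' inf_le_left
      hne fun p hp d hd ↦ ⟨P.1.mul_mem (P.1.mul_mem hp hd.1) (P.1.inv_mem hp), hK.conj_mem d hd.2 p⟩
    exact hφd (invariant_hom_eq_zero P.1 K hP hPK hpow hmin hext φ hφ hφP d hd)
  have hcompl : Subgroup.IsComplement' K P.1 :=
    Subgroup.isComplement'_of_disjoint_and_mul_eq_univ (disjoint_iff.2 hdisj).symm (by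
      rw [← Subgroup.normal_mul, sup_comm, hPK, Subgroup.coe_top])
  exact ⟨K, hK, hcompl.index_eq_card ▸ hP, k, hk⟩

/-- If every nonlinear real-valued irreducible character of a finite group `G` has even
degree, then `G` has a normal `2`-complement: a normal subgroup of odd order whose
index is a power of `2`. -/
theorem normal_two_complement_of_even_real_degrees
    (G : Type) [Group G] [Fintype G]
    (hdeg : ∀ χ : G → ℂ, IsIrrChar G χ → IsRealValued χ → χ 1 ≠ 1 →
      ∃ n : ℕ, Even n ∧ χ 1 = (n : ℂ)) :
    ∃ N : Subgroup G, N.Normal ∧ Odd (Nat.card ↥N) ∧ ∃ k : ℕ, N.index = 2 ^ k := by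
  obtain ⟨P⟩ : Nonempty (Sylow 2 G) := inferInstance
  refine exists_normal_two_complement_of_extends P
    (exists_normal_extending_kernel hdeg P.1 ?_)
  rw [← Nat.not_even_iff_odd, even_iff_two_dvd]
  exact P.not_dvd_index
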